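/- arXiv:1602.00757 — 2 statements merged into one kernel-verified Lean document; each statement's English description precedes it below -/
import Mathlib

section
/- Let n ≥ 1 and let f : ℝ^{n+1} → ℝ be bounded, of class C², and compactly supported. Then for every (t,x) ∈ ℝ × ℝⁿ the integral u(t,x) = ∫₀^∞ ∫_{ℝⁿ} W(τ,y) f(t−τ, x−y) dy dτ is absolutely convergent, and the function u so defined is a classical solution of the heat equation ∂_t u = Δu + f on ℝ^{n+1}. -/
open MeasureTheory Filter Set Metric
open scoped ENNReal NNReal Topology

noncomputable section

abbrev En (n : ℕ) := EuclideanSpace ℝ (Fin n)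

/-- The Gauss–Weierstrass kernel `W(τ,y) = (4πτ)^{-n/2} exp(-|y|²/(4τ))`, extended by `0`
for `τ ≤ 0`. -/
def W (n : ℕ) (τ : ℝ) (y : En n) : ℝ :=
  if 0 < τ then (4 * Real.pi * τ) ^ (-(n : ℝ) / 2) * Real.exp (-‖y‖ ^ 2 / (4 * τ)) else 0

/-- Partial derivative of `g : ℝⁿ → ℝ` in the `i`-th coordinate direction. -/
def pd {n : ℕ} (i : Fin n) (g : En n → ℝ) (y : En n) : ℝ :=
  fderiv ℝ g y (EuclideanSpace.single i 1)

/-- Laplacian of `g : ℝⁿ → ℝ`. -/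
def lap {n : ℕ} (g : En n → ℝ) (x : En n) : ℝ :=
  ∑ i : Fin n, pd i (pd i g) x

lemma W_nonneg (n : ℕ) (τ : ℝ) (y : En n) : 0 ≤ W n τ y := by
  unfold W
  split_ifs <;> positivity

lemma measurable_W (n : ℕ) : Measurable (fun p : ℝ × En n => W n p.1 p.2) := by
  unfold W
  refine Measurable.ite (measurableSet_lt measurable_const measurable_fst) ?_ measurable_const
  fun_prop

lemma W_one (n : ℕ) (y : En n) :
    W n 1 y = (4 * Real.pi) ^ (-(n : ℝ) / 2) * Real.exp (-(1 / 4) * ‖y‖ ^ 2) := by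
  simp only [W, zero_lt_one, if_true, mul_one]
  ring_nf

lemma integrable_exp_neg_mul_sq_norm (n : ℕ) {b : ℝ} (hb : 0 < b) :
    Integrable (fun y : En n => Real.exp (-b * ‖y‖ ^ 2)) := by
  refine .of_integral_ne_zero ?_
  rw [GaussianFourier.integral_rexp_neg_mul_sq_norm hb]
  positivity

lemma continuous_W_one (n : ℕ) : Continuous (W n 1) := by
  simp only [funext (W_one n)]
  fun_prop

lemma integrable_W_one (n : ℕ) : Integrable (W n 1) := by
  simp only [funext (W_one n)]
  exact (integrable_exp_neg_mul_sq_norm n (by norm_num)).const_mul _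

lemma integrable_W_one_mul_norm (n : ℕ) : Integrable (fun y : En n => W n 1 y * ‖y‖) := by
  have hb : Integrable (fun y : En n =>
      (4 * Real.pi) ^ (-(n : ℝ) / 2) * (4 * Real.exp (-(1 / 8) * ‖y‖ ^ 2))) :=
    ((integrable_exp_neg_mul_sq_norm n (by norm_num)).const_mul _).const_mul _
  refine hb.mono' ((continuous_W_one n).mul continuous_norm).aestronglyMeasurable
    (.of_forall fun y => ?_)
  rw [Real.norm_of_nonneg (mul_nonneg (W_nonneg n 1 y) (norm_nonneg y)), W_one, mul_assoc,
    mul_comm _ ‖y‖]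
  refine mul_le_mul_of_nonneg_left ?_ (by positivity)
  have h1 : Real.exp (-(1 / 4) * ‖y‖ ^ 2)
      = Real.exp (-(1 / 8) * ‖y‖ ^ 2) * Real.exp (-(1 / 8) * ‖y‖ ^ 2) := by
    rw [← Real.exp_add]; ring_nf
  have h2 : Real.exp (-(1 / 8) * ‖y‖ ^ 2) * Real.exp (1 / 8 * ‖y‖ ^ 2) = 1 := by
    rw [← Real.exp_add]; simp
  have h3 : ‖y‖ ≤ 4 * Real.exp (1 / 8 * ‖y‖ ^ 2) := by
    nlinarith [Real.add_one_le_exp (1 / 8 * ‖y‖ ^ 2), sq_nonneg (‖y‖ - 1)]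
  calc ‖y‖ * Real.exp (-(1 / 4) * ‖y‖ ^ 2)
      ≤ 4 * Real.exp (1 / 8 * ‖y‖ ^ 2) * Real.exp (-(1 / 4) * ‖y‖ ^ 2) := by gcongr
    _ = 4 * Real.exp (-(1 / 8) * ‖y‖ ^ 2) *
        (Real.exp (-(1 / 8) * ‖y‖ ^ 2) * Real.exp (1 / 8 * ‖y‖ ^ 2)) := by rw [h1]; ring
    _ = _ := by rw [h2, mul_one]

lemma integral_W_one (n : ℕ) : ∫ y : En n, W n 1 y = 1 := by
  simp only [funext (W_one n), integral_const_mul]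
  rw [GaussianFourier.integral_rexp_neg_mul_sq_norm (by norm_num), finrank_euclideanSpace_fin,
    show Real.pi / (1 / 4) = 4 * Real.pi by ring, ← Real.rpow_add (by positivity)]
  simp [neg_div]

lemma hasFDerivAt_W_one (n : ℕ) (y : En n) :
    HasFDerivAt (W n 1) ((-(1 / 2) * W n 1 y) • innerSL ℝ y) y := by
  simp only [funext (W_one n)]
  refine (((hasStrictFDerivAt_norm_sq y).hasFDerivAt.const_mul (-(1 / 4))).exp.const_mul
    ((4 * Real.pi) ^ (-(n : ℝ) / 2))).congr_fderiv ?_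
  ext v
  simp
  ring

/-- Parabolic rescaling of the heat kernel to unit time. -/
lemma W_sqrt_smul (n : ℕ) {τ : ℝ} (hτ : 0 < τ) (y : En n) :
    W n τ (√τ • y) = |(√τ ^ Module.finrank ℝ (En n))⁻¹| * W n 1 y := by
  have h : √τ ^ n = τ ^ ((n : ℝ) / 2) := by
    rw [Real.sqrt_eq_rpow, ← Real.rpow_natCast, ← Real.rpow_mul hτ.le]
    ring_nf
  rw [finrank_euclideanSpace_fin, abs_of_nonneg (by positivity), h, W_one, W, if_pos hτ,
    Real.mul_rpow (by positivity) hτ.le, norm_smul, mul_pow, Real.norm_of_nonneg (by positivity),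
    Real.sq_sqrt hτ.le, ← Real.rpow_neg hτ.le, show -(τ * ‖y‖ ^ 2) / (4 * τ) = -(1 / 4) * ‖y‖ ^ 2 by
      field_simp, neg_div]
  ring

lemma integral_W_mul (n : ℕ) {τ : ℝ} (hτ : 0 < τ) (h : En n → ℝ) :
    ∫ y, W n τ y * h y = ∫ y, W n 1 y * h (√τ • y) := by
  have hs : |(√τ ^ Module.finrank ℝ (En n))⁻¹| ≠ 0 := by
    have := Real.sqrt_pos.2 hτ
    positivity
  have := Measure.integral_comp_smul volume (fun y => W n τ y * h y) (√τ)
  simp only [W_sqrt_smul n hτ, mul_assoc, integral_const_mul, smul_eq_mul] at this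
  exact (mul_left_cancel₀ hs this).symm

lemma integral_W (n : ℕ) {τ : ℝ} (hτ : 0 < τ) : ∫ y, W n τ y = 1 := by
  simpa [integral_W_one] using integral_W_mul n hτ (fun _ => 1)

lemma locallyIntegrable_W (n : ℕ) : LocallyIntegrable (fun p : ℝ × En n => W n p.1 p.2) := by
  rw [locallyIntegrable_iff]
  intro K hK
  obtain ⟨R, hR⟩ := hK.isBounded.subset_closedBall 0
  have hsub : K ⊆ Icc (-R) R ×ˢ univ := fun p hp => by
    have := (norm_fst_le p).trans (mem_closedBall_zero_iff.1 (hR hp))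
    exact ⟨abs_le.1 this, trivial⟩
  refine IntegrableOn.mono_set ?_ hsub
  rw [IntegrableOn, Measure.volume_eq_prod, ← Measure.prod_restrict, Measure.restrict_univ,
    integrable_prod_iff (measurable_W n).aestronglyMeasurable]
  refine ⟨.of_forall fun τ => ?_, ?_⟩
  · rcases lt_or_ge 0 τ with hτ | hτ
    · exact .of_integral_ne_zero (by simp [integral_W n hτ])
    · simp [W, hτ.not_gt]
  · refine Integrable.of_bound (C := 1)
      (measurable_W n).stronglyMeasurable.norm.integral_prod_right'.aestronglyMeasurable
      (.of_forall fun τ => ?_)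
    simp only [Real.norm_of_nonneg (W_nonneg n τ _)]
    rcases lt_or_ge 0 τ with hτ | hτ
    · simp [integral_W n hτ]
    · simp [W, hτ.not_gt]

/-- Space-time convolution of `h` with the heat kernel. -/
def heatConv (n : ℕ) (h : ℝ × En n → ℝ) (z : ℝ × En n) : ℝ :=
  ∫ p : ℝ × En n, W n p.1 p.2 * h (z - p)

lemma heatConv_eq_convolution (n : ℕ) (h : ℝ × En n → ℝ) :
    heatConv n h = MeasureTheory.convolution (fun p : ℝ × En n => W n p.1 p.2) h
      (ContinuousLinearMap.mul ℝ ℝ) volume := rfl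

instance volume_prod_isAddHaarMeasure (n : ℕ) :
    (volume : Measure (ℝ × En n)).IsAddHaarMeasure := by
  rw [Measure.volume_eq_prod]
  infer_instance

lemma integrable_W_mul {n : ℕ} {h : ℝ × En n → ℝ} (hh : Continuous h) (hc : HasCompactSupport h)
    (z : ℝ × En n) : Integrable (fun p : ℝ × En n => W n p.1 p.2 * h (z - p)) :=
  hc.convolutionExists_right (ContinuousLinearMap.mul ℝ ℝ) (locallyIntegrable_W n) hh z

lemma contDiff_heatConv {n : ℕ} {h : ℝ × En n → ℝ} {k : ℕ∞} (hh : ContDiff ℝ k h)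
    (hc : HasCompactSupport h) : ContDiff ℝ k (heatConv n h) :=
  hc.contDiff_convolution_right (ContinuousLinearMap.mul ℝ ℝ) (locallyIntegrable_W n) hh

lemma fderiv_heatConv {n : ℕ} {h : ℝ × En n → ℝ} (hh : ContDiff ℝ 1 h)
    (hc : HasCompactSupport h) (z v : ℝ × En n) :
    fderiv ℝ (heatConv n h) z v = heatConv n (fun w => fderiv ℝ h w v) z := by
  rw [heatConv_eq_convolution, (hc.hasFDerivAt_convolution_right
    (ContinuousLinearMap.mul ℝ ℝ) (locallyIntegrable_W n) hh z).fderiv]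
  exact convolution_precompR_apply _ (locallyIntegrable_W n) (hc.fderiv ℝ)
    (hh.continuous_fderiv one_ne_zero) z v

lemma contDiff_fderiv_apply_one {E : Type*} [NormedAddCommGroup E] [NormedSpace ℝ E] {f : E → ℝ}
    (hf : ContDiff ℝ 2 f) (v : E) : ContDiff ℝ 1 (fun w => fderiv ℝ f w v) :=
  (hf.fderiv_right (m := 1) (by norm_num)).clm_apply contDiff_const

lemma pd_comp_mk {n : ℕ} {g : ℝ × En n → ℝ} (hg : Differentiable ℝ g) (i : Fin n) (t : ℝ)
    (x : En n) : pd i (fun y => g (t, y)) x = fderiv ℝ g (t, x) (0, EuclideanSpace.single i 1) := by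
  have h := (hg (t, x)).hasFDerivAt.comp x (hasFDerivAt_prodMk_right t x)
  rw [pd, show (fun y => g (t, y)) = g ∘ fun y => (t, y) from rfl, h.fderiv]
  simp

lemma integrable_W_one_mul_coord {n : ℕ} {G : En n → ℝ} (hG : Continuous G) {C : ℝ}
    (hC : ∀ y, ‖G y‖ ≤ C) (i : Fin n) : Integrable (fun y : En n => W n 1 y * (y i * G y)) := by
  have := (integrable_W_one_mul_norm n).mul_const C
  refine this.mono' (((continuous_W_one n).mul
    ((EuclideanSpace.proj i : En n →L[ℝ] ℝ).continuous.mul hG)).aestronglyMeasurable)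
    (.of_forall fun y => ?_)
  rw [norm_mul, norm_mul, Real.norm_of_nonneg (W_nonneg n 1 y), mul_assoc]
  have := W_nonneg n 1 y
  have := PiLp.norm_apply_le y i
  have := hC y
  gcongr

/-- Gaussian integration by parts. -/
lemma integral_W_one_mul_coord {n : ℕ} {G : En n → ℝ} (hG : ContDiff ℝ 1 G) {C C' : ℝ}
    (hC : ∀ y, ‖G y‖ ≤ C) (i : Fin n)
    (hC' : ∀ y, ‖fderiv ℝ G y (EuclideanSpace.single i 1)‖ ≤ C') :
    ∫ y, W n 1 y * (y i * G y) =
      2 * ∫ y, W n 1 y * fderiv ℝ G y (EuclideanSpace.single i 1) := by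
  have hG' : Continuous (fun y => fderiv ℝ G y (EuclideanSpace.single i 1)) :=
    (hG.continuous_fderiv one_ne_zero).clm_apply continuous_const
  have hd : ∀ y : En n, fderiv ℝ (W n 1) y (EuclideanSpace.single i 1) * G y
      = -(1 / 2) * (W n 1 y * (y i * G y)) := fun y => by
    rw [(hasFDerivAt_W_one n y).fderiv]
    simp [EuclideanSpace.inner_single_right]
    ring
  have hi := integrable_W_one_mul_coord hG.continuous hC i
  rw [integral_mul_fderiv_eq_neg_fderiv_mul_of_integrable]
  · simp only [hd, integral_const_mul]
    ring
  · simp only [hd]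
    exact hi.const_mul _
  · exact (integrable_W_one n).mul_bdd hG'.aestronglyMeasurable (.of_forall hC')
  · exact (integrable_W_one n).mul_bdd hG.continuous.aestronglyMeasurable (.of_forall hC)
  · exact fun y _ => (hasFDerivAt_W_one n y).differentiableAt
  · exact fun y _ => hG.differentiable one_ne_zero y

/-- The heat operator `∂_t - Δ` on functions of space-time. -/
def heatOp {n : ℕ} (f : ℝ × En n → ℝ) (z : ℝ × En n) : ℝ :=
  fderiv ℝ f z (1, 0) - ∑ i : Fin n,
    fderiv ℝ (fun w => fderiv ℝ f w (0, EuclideanSpace.single i 1)) z (0, EuclideanSpace.single i 1)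

lemma continuous_fderiv_fderiv_apply {E : Type*} [NormedAddCommGroup E] [NormedSpace ℝ E]
    {f : E → ℝ} (hf : ContDiff ℝ 2 f) (v : E) :
    Continuous (fun z => fderiv ℝ (fun w => fderiv ℝ f w v) z v) :=
  ((contDiff_fderiv_apply_one hf v).continuous_fderiv one_ne_zero).clm_apply continuous_const

lemma continuous_heatOp {n : ℕ} {f : ℝ × En n → ℝ} (hf : ContDiff ℝ 2 f) :
    Continuous (heatOp f) :=
  (contDiff_fderiv_apply_one hf _).continuous.sub
    (continuous_finsetSum _ fun _ _ => continuous_fderiv_fderiv_apply hf _)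

lemma heatConv_heatOp_eq_sub {n : ℕ} {f : ℝ × En n → ℝ} (hf : ContDiff ℝ 2 f)
    (hc : HasCompactSupport f) (z : ℝ × En n) :
    heatConv n (heatOp f) z = heatConv n (fun w => fderiv ℝ f w (1, 0)) z -
      ∑ i : Fin n, heatConv n (fun z => fderiv ℝ
        (fun w => fderiv ℝ f w (0, EuclideanSpace.single i 1)) z
          (0, EuclideanSpace.single i 1)) z := by
  have h1 := integrable_W_mul (contDiff_fderiv_apply_one hf (1, 0)).continuous
    (hc.fderiv_apply ℝ _) z
  have h2 := fun i : Fin n => integrable_W_mul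
    (continuous_fderiv_fderiv_apply hf (0, EuclideanSpace.single i 1))
    ((hc.fderiv_apply ℝ _).fderiv_apply ℝ _) z
  simp only [heatConv, heatOp, mul_sub, Finset.mul_sum]
  rw [integral_sub h1 (integrable_finsetSum _ fun i _ => h2 i),
    integral_finsetSum _ fun i _ => h2 i]

lemma hasCompactSupport_heatOp {n : ℕ} {f : ℝ × En n → ℝ} (hc : HasCompactSupport f) :
    HasCompactSupport (heatOp f) := by
  refine HasCompactSupport.intro hc fun z hz => ?_
  have h1 : ∀ v : ℝ × En n, fderiv ℝ f z v = 0 := fun v =>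
    image_eq_zero_of_notMem_tsupport (f := fun z => fderiv ℝ f z v) fun h =>
      hz (tsupport_fderiv_apply_subset ℝ v h)
  have h2 : ∀ v : ℝ × En n, fderiv ℝ (fun w => fderiv ℝ f w v) z v = 0 := fun v =>
    image_eq_zero_of_notMem_tsupport
      (f := fun z => fderiv ℝ (fun w => fderiv ℝ f w v) z v) fun h =>
      hz (tsupport_fderiv_apply_subset ℝ v (tsupport_fderiv_apply_subset ℝ v h))
  simp [heatOp, h1, h2]

lemma integral_W_one_mul_comp_smul_coord {n : ℕ} {g : ℝ × En n → ℝ} (hg : ContDiff ℝ 1 g)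
    (hc : HasCompactSupport g) (t s : ℝ) (x : En n) (i : Fin n) :
    ∫ y, W n 1 y * (y i * g (t, x - s • y)) = -(2 * s) *
      ∫ y, W n 1 y * fderiv ℝ g (t, x - s • y) (0, EuclideanSpace.single i 1) := by
  obtain ⟨C, hC⟩ := hc.exists_bound_of_continuous hg.continuous
  obtain ⟨C', hC'⟩ := (hc.fderiv_apply ℝ (0, EuclideanSpace.single i 1)).exists_bound_of_continuous
    ((hg.continuous_fderiv one_ne_zero).clm_apply continuous_const)
  have hd : ∀ y : En n, fderiv ℝ (fun y => g (t, x - s • y)) y (EuclideanSpace.single i 1)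
      = -s * fderiv ℝ g (t, x - s • y) (0, EuclideanSpace.single i 1) := fun y => by
    have h1 : HasFDerivAt (fun y : En n => (t, x - s • y))
        ((0 : En n →L[ℝ] ℝ).prod (-(s • ContinuousLinearMap.id ℝ (En n)))) y :=
      (hasFDerivAt_const t y).prodMk (((hasFDerivAt_id (𝕜 := ℝ) y).const_smul s).const_sub x)
    have h2 := HasFDerivAt.comp y
      (hg.differentiable one_ne_zero (t, x - s • y)).hasFDerivAt h1
    rw [show (fun y => g (t, x - s • y)) = g ∘ fun y => (t, x - s • y) from rfl, h2.fderiv]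
    have : ((0 : ℝ), -(s • (EuclideanSpace.single i 1 : En n)))
        = (-s) • (0, EuclideanSpace.single i 1) := by simp
    change fderiv ℝ g (t, x - s • y) (0, -(s • EuclideanSpace.single i 1)) = _
    rw [this, map_smul, smul_eq_mul]
  have hG : ContDiff ℝ 1 (fun y : En n => g (t, x - s • y)) := by fun_prop
  rw [integral_W_one_mul_coord hG (fun y => hC _) i (C' := |s| * C')]
  · simp only [hd]
    rw [← integral_const_mul, ← integral_const_mul]
    congr with y
    ring
  · intro y
    rw [hd, norm_mul, norm_neg, Real.norm_eq_abs]
    exact mul_le_mul_of_nonneg_left (hC' _) (abs_nonneg s)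

/-- The spatial heat average of `f (t - τ, ·)` at scale `√τ`, written with the unit-time kernel. -/
def heatAvg (n : ℕ) (f : ℝ × En n → ℝ) (t : ℝ) (x : En n) (τ : ℝ) : ℝ :=
  ∫ y, W n 1 y * f (t - τ, x - √τ • y)

lemma continuous_heatAvg {n : ℕ} {f : ℝ × En n → ℝ} (hf : Continuous f)
    (hc : HasCompactSupport f) (t : ℝ) (x : En n) : Continuous (heatAvg n f t x) := by
  obtain ⟨C, hC⟩ := hc.exists_bound_of_continuous hf
  refine continuous_of_dominated (bound := fun y => W n 1 y * C) (fun τ => ?_) (fun τ => ?_)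
    ((integrable_W_one n).mul_const C) (.of_forall fun y => by fun_prop)
  · exact ((continuous_W_one n).mul (by fun_prop)).aestronglyMeasurable
  · refine .of_forall fun y => ?_
    rw [norm_mul, Real.norm_of_nonneg (W_nonneg n 1 y)]
    exact mul_le_mul_of_nonneg_left (hC _) (W_nonneg n 1 y)

lemma heatAvg_zero (n : ℕ) (f : ℝ × En n → ℝ) (t : ℝ) (x : En n) :
    heatAvg n f t x 0 = f (t, x) := by
  simp [heatAvg, integral_mul_const, integral_W_one]

lemma tendsto_heatAvg_atTop {n : ℕ} {f : ℝ × En n → ℝ} (hc : HasCompactSupport f) (t : ℝ)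
    (x : En n) : Tendsto (heatAvg n f t x) atTop (𝓝 0) := by
  obtain ⟨R, hR⟩ := hc.isBounded.subset_closedBall 0
  refine tendsto_const_nhds.congr' ?_
  filter_upwards [eventually_gt_atTop (t + R)] with τ hτ
  have hz : ∀ y : En n, f (t - τ, x - √τ • y) = 0 := fun y => by
    refine image_eq_zero_of_notMem_tsupport fun h => ?_
    have := (norm_fst_le _).trans (mem_closedBall_zero_iff.1 (hR h))
    have := (abs_le.1 this).1
    simp only at this
    linarith
  simp [heatAvg, hz]

lemma apply_neg_one_neg_smul {n : ℕ} (L : ℝ × En n →L[ℝ] ℝ) (c : ℝ) (y : En n) :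
    L (-1, -(c • y)) = -L (1, 0) - c * ∑ i, y i * L (0, EuclideanSpace.single i 1) := by
  have hy : ((-1 : ℝ), -(c • y)) = -(1, 0) - c • (0, y) := by simp
  have hs : ((0 : ℝ), y) = ∑ i, y i • ((0 : ℝ), (EuclideanSpace.single i 1 : En n)) := by
    have := (EuclideanSpace.basisFun (Fin n) ℝ).sum_repr y
    simp only [EuclideanSpace.basisFun_repr, EuclideanSpace.basisFun_apply] at this
    ext1
    · simp [Prod.fst_sum]
    · simp [Prod.snd_sum, this]
  rw [hy, hs, map_sub, map_neg, map_smul, map_sum]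
  simp only [map_smul, smul_eq_mul]

lemma hasDerivAt_heatAvg {n : ℕ} {f : ℝ × En n → ℝ} (hf : ContDiff ℝ 2 f)
    (hc : HasCompactSupport f) (t : ℝ) (x : En n) {τ : ℝ} (hτ : 0 < τ) :
    HasDerivAt (heatAvg n f t x) (-heatAvg n (heatOp f) t x τ) τ := by
  obtain ⟨M, hM⟩ := hc.exists_bound_of_continuous hf.continuous
  have hf1 : Continuous (fderiv ℝ f) := hf.continuous_fderiv two_ne_zero
  obtain ⟨C, hC⟩ := (hc.fderiv ℝ).exists_bound_of_continuous hf1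
  have hC0 : 0 ≤ C := (norm_nonneg _).trans (hC 0)
  have key := hasDerivAt_integral_of_dominated_loc_of_deriv_le (μ := volume) (x₀ := τ)
    (F := fun τ y => W n 1 y * f (t - τ, x - √τ • y))
    (F' := fun τ y => W n 1 y * fderiv ℝ f (t - τ, x - √τ • y) (-1, -((1 / (2 * √τ)) • y)))
    (bound := fun y => C * W n 1 y + C * (1 / (2 * √(τ / 2))) * (W n 1 y * ‖y‖))
    (s := Ioi (τ / 2)) (Ioi_mem_nhds (by linarith))
    (.of_forall fun σ => ((continuous_W_one n).mul
      (hf.continuous.comp (by fun_prop))).aestronglyMeasurable)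
    ((integrable_W_one n).mul_bdd
      (hf.continuous.comp (by fun_prop)).aestronglyMeasurable (.of_forall fun y => hM _))
    ((continuous_W_one n).mul ((hf1.comp (by fun_prop)).clm_apply
      (by fun_prop))).aestronglyMeasurable
    (.of_forall fun y σ hσ => ?_)
    (((integrable_W_one n).const_mul _).add ((integrable_W_one_mul_norm n).const_mul _))
    (.of_forall fun y σ hσ => ?_)
  · refine key.2.congr_deriv ?_
    have hi1 : Integrable (fun y => W n 1 y * fderiv ℝ f (t - τ, x - √τ • y) (1, 0)) :=
      (integrable_W_one n).mul_bdd
        ((hf1.comp (by fun_prop)).clm_apply continuous_const).aestronglyMeasurable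
        (.of_forall fun y => (ContinuousLinearMap.le_opNorm _ _).trans
          (mul_le_mul_of_nonneg_right (hC _) (norm_nonneg _)))
    have hi2 := fun i : Fin n => integrable_W_one_mul_coord
      (G := fun y => fderiv ℝ f (t - τ, x - √τ • y) (0, EuclideanSpace.single i 1))
      ((hf1.comp (by fun_prop)).clm_apply continuous_const)
      (fun y => (ContinuousLinearMap.le_opNorm _ _).trans
          (mul_le_mul_of_nonneg_right (hC _) (norm_nonneg _))) i
    have hi3 : ∀ i : Fin n, Integrable (fun y => W n 1 y * fderiv ℝ
        (fun w => fderiv ℝ f w (0, EuclideanSpace.single i 1)) (t - τ, x - √τ • y)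
          (0, EuclideanSpace.single i 1)) := fun i => by
      have hd := continuous_fderiv_fderiv_apply hf (0, EuclideanSpace.single i 1)
      obtain ⟨B, hB⟩ := ((hc.fderiv_apply ℝ (0, EuclideanSpace.single i 1)).fderiv_apply ℝ
        (0, EuclideanSpace.single i 1)).exists_bound_of_continuous hd
      exact (integrable_W_one n).mul_bdd (hd.comp (by fun_prop)).aestronglyMeasurable
        (.of_forall fun y => hB _)
    have hsplit : ∀ y : En n, W n 1 y * fderiv ℝ f (t - τ, x - √τ • y) (-1, -((1 / (2 * √τ)) • y))
        = -(W n 1 y * fderiv ℝ f (t - τ, x - √τ • y) (1, 0)) - 1 / (2 * √τ) *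
          ∑ i, W n 1 y *
            (y i * fderiv ℝ f (t - τ, x - √τ • y) (0, EuclideanSpace.single i 1)) := fun y => by
      rw [apply_neg_one_neg_smul, ← Finset.mul_sum]
      ring
    have hs : √τ ≠ 0 := (Real.sqrt_pos.2 hτ).ne'
    simp only [heatAvg, hsplit, heatOp, mul_sub, Finset.mul_sum Finset.univ _ (W n 1 _)]
    rw [integral_sub (by exact hi1.neg) ((integrable_finsetSum _ fun i _ => hi2 i).const_mul _),
      integral_neg, integral_const_mul, integral_finsetSum _ fun i _ => hi2 i,
      integral_sub hi1 (integrable_finsetSum _ fun i _ => hi3 i),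
      integral_finsetSum _ fun i _ => hi3 i]
    simp only [integral_W_one_mul_comp_smul_coord (contDiff_fderiv_apply_one hf _)
      (hc.fderiv_apply ℝ _), ← Finset.mul_sum]
    field_simp
    ring
  · have hσ' : √(τ / 2) ≤ √σ := Real.sqrt_le_sqrt (le_of_lt hσ)
    have hW := W_nonneg n 1 y
    have hn : ‖((-1 : ℝ), -((1 / (2 * √σ)) • y))‖ ≤ 1 + 1 / (2 * √(τ / 2)) * ‖y‖ := by
      have h1 : 1 / (2 * √σ) * ‖y‖ ≤ 1 / (2 * √(τ / 2)) * ‖y‖ := by gcongr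
      rw [Prod.norm_mk, norm_neg, norm_neg, norm_one, norm_smul,
        Real.norm_of_nonneg (by positivity)]
      refine max_le (le_add_of_nonneg_right (by positivity)) (h1.trans ?_)
      linarith
    rw [norm_mul, Real.norm_of_nonneg hW]
    calc _ ≤ W n 1 y * (C * (1 + 1 / (2 * √(τ / 2)) * ‖y‖)) := by
          refine mul_le_mul_of_nonneg_left ?_ hW
          exact (ContinuousLinearMap.le_opNorm _ _).trans
            (mul_le_mul (hC _) hn (norm_nonneg _) hC0)
      _ = _ := by ring
  · have hσ0 : 0 < σ := (half_pos hτ).trans hσ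
    refine HasDerivAt.const_mul _ ?_
    exact (hf.differentiable two_ne_zero (t - σ, x - √σ • y)).hasFDerivAt.comp_hasDerivAt_of_eq σ
      (((hasDerivAt_id σ).const_sub t).prodMk
        (((Real.hasDerivAt_sqrt hσ0.ne').smul_const y).const_sub x)) rfl

/-- Duhamel's principle: convolution with the heat kernel inverts the heat operator. -/
lemma heatConv_heatOp {n : ℕ} {f : ℝ × En n → ℝ} (hf : ContDiff ℝ 2 f)
    (hc : HasCompactSupport f) (z : ℝ × En n) : heatConv n (heatOp f) z = f z := by
  obtain ⟨t, x⟩ := z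
  have hint := integrable_W_mul (continuous_heatOp hf) (hasCompactSupport_heatOp hc) (t, x)
  rw [Measure.volume_eq_prod] at hint
  have hslice : ∀ τ ∈ Ioi (0 : ℝ), ∫ y, W n τ y * heatOp f ((t, x) - (τ, y))
      = heatAvg n (heatOp f) t x τ := fun τ hτ =>
    integral_W_mul n hτ fun y => heatOp f (t - τ, x - y)
  have hslice' : ∀ τ ∈ (Ioi (0 : ℝ))ᶜ, ∫ y, W n τ y * heatOp f ((t, x) - (τ, y)) = 0 :=
    fun τ hτ => by simp [W, show ¬ 0 < τ from hτ]
  have hon : IntegrableOn (heatAvg n (heatOp f) t x) (Ioi 0) :=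
    (hint.integral_prod_left.integrableOn (s := Ioi 0)).congr_fun hslice measurableSet_Ioi
  have hftc := integral_Ioi_of_hasDerivAt_of_tendsto
    (continuous_heatAvg hf.continuous hc t x).continuousWithinAt
    (fun τ hτ => hasDerivAt_heatAvg hf hc t x hτ) hon.neg (tendsto_heatAvg_atTop hc t x)
  rw [integral_neg, heatAvg_zero] at hftc
  rw [heatConv, Measure.volume_eq_prod, integral_prod _ hint,
    ← setIntegral_eq_integral_of_forall_compl_eq_zero hslice',
    setIntegral_congr_fun measurableSet_Ioi hslice]
  linarith

/-- for `f` bounded, `C²` and compactly supported on `ℝ^{n+1}`, the integral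
`u(t,x) = ∫₀^∞ ∫_{ℝⁿ} W(τ,y) f(t-τ, x-y) dy dτ` converges absolutely (the kernel vanishes for
`τ ≤ 0`, so the integral over `ℝ × ℝⁿ` is the integral over `(0,∞) × ℝⁿ`), `u(t,·)` is of
class `C²`, and `u` is a classical solution of the heat equation `∂_t u = Δu + f`. -/
theorem heat_global_classical_solvability (n : ℕ) (hn : 1 ≤ n)
    (f : ℝ × En n → ℝ) (hfb : ∃ M, ∀ z, |f z| ≤ M) (hf2 : ContDiff ℝ 2 f)
    (hfc : HasCompactSupport f) :
    (∀ (t : ℝ) (x : En n),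
      Integrable (fun p : ℝ × En n => W n p.1 p.2 * f (t - p.1, x - p.2))) ∧
    (∀ t : ℝ, ContDiff ℝ 2
      (fun x : En n => ∫ p : ℝ × En n, W n p.1 p.2 * f (t - p.1, x - p.2))) ∧
    (∀ (t : ℝ) (x : En n),
      HasDerivAt (fun s : ℝ => ∫ p : ℝ × En n, W n p.1 p.2 * f (s - p.1, x - p.2))
        (lap (fun x' : En n => ∫ p : ℝ × En n, W n p.1 p.2 * f (t - p.1, x' - p.2)) x
          + f (t, x)) t) := by
  have hI : ∀ (t : ℝ) (x : En n), ∫ p : ℝ × En n, W n p.1 p.2 * f (t - p.1, x - p.2)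
      = heatConv n f (t, x) := fun t x => rfl
  simp only [hI]
  have hu : ContDiff ℝ 2 (heatConv n f) := contDiff_heatConv (k := 2) hf2 hfc
  have hf1 : ContDiff ℝ 1 f := hf2.of_le (by norm_num)
  refine ⟨fun t x => integrable_W_mul hf2.continuous hfc (t, x), fun t => by fun_prop,
    fun t x => ?_⟩
  have ht : HasDerivAt (fun s => heatConv n f (s, x))
      (fderiv ℝ (heatConv n f) (t, x) (1, 0)) t :=
    ((hu.differentiable two_ne_zero (t, x)).hasFDerivAt.comp_hasDerivAt_of_eq t
      ((hasDerivAt_id t).prodMk (hasDerivAt_const t x)) rfl)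
  refine ht.congr_deriv ?_
  have hlap : ∀ i : Fin n, pd i (pd i fun y => heatConv n f (t, y)) x =
      heatConv n (fun z => fderiv ℝ (fun w => fderiv ℝ f w (0, EuclideanSpace.single i 1)) z
        (0, EuclideanSpace.single i 1)) (t, x) := fun i => by
    have hfi := contDiff_fderiv_apply_one hf2 (0, EuclideanSpace.single i 1)
    have hci : HasCompactSupport (fun w => fderiv ℝ f w (0, EuclideanSpace.single i 1)) :=
      hfc.fderiv_apply ℝ _
    have h1 : (pd i fun y => heatConv n f (t, y)) = fun y =>
        heatConv n (fun w => fderiv ℝ f w (0, EuclideanSpace.single i 1)) (t, y) := by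
      funext y
      rw [pd_comp_mk (hu.differentiable two_ne_zero), fderiv_heatConv hf1 hfc]
    rw [h1, pd_comp_mk ((contDiff_heatConv (k := 1) hfi hci).differentiable one_ne_zero),
      fderiv_heatConv hfi hci]
  rw [fderiv_heatConv hf1 hfc, ← heatConv_heatOp hf2 hfc (t, x),
    heatConv_heatOp_eq_sub hf2 hfc, lap, Finset.sum_congr rfl fun i _ => hlap i]
  ring
end
end

section
/- Let n ≥ 1 and fix i ∈ {1,…,n}. Then lim_{ε→0} ∫₀^{ε²} ∫_{|y|=ε} S(τ) ∂_{y_i} H(τ,y) (y_i/|y|) dσ(y) dτ = −(1/(n Γ(n/2))) ∫_{1/4}^∞ e^{−u} u^{n/2 − 1} du. -/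
open MeasureTheory Filter Set Metric
open scoped ENNReal NNReal Topology

noncomputable section

/-- The hyperbolic cotangent. -/
def coth (τ : ℝ) : ℝ := Real.cosh τ / Real.sinh τ

/-- The factor `S(τ) = (2π sinh 2τ)^{-n/2}` of the Mehler kernel. -/
def Sfac (n : ℕ) (τ : ℝ) : ℝ := (2 * Real.pi * Real.sinh (2 * τ)) ^ (-(n : ℝ) / 2)

/-- The factor `H(τ,y) = exp(-(1/4)|y|² coth τ)` of the Mehler kernel. -/
def Hker (n : ℕ) (τ : ℝ) (y : En n) : ℝ := Real.exp (-(1 / 4) * ‖y‖ ^ 2 * coth τ)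

open scoped Pointwise in
theorem LinearIsometryEquiv.measurePreserving_toSphere {E : Type*} [NormedAddCommGroup E]
    [InnerProductSpace ℝ E] [FiniteDimensional ℝ E] [MeasurableSpace E] [BorelSpace E]
    (L : E ≃ₗᵢ[ℝ] E) :
    MeasurePreserving (fun x : sphere (0 : E) 1 => (⟨L x, by simp⟩ : sphere (0 : E) 1))
      (volume : Measure E).toSphere (volume : Measure E).toSphere := by
  have hm : Measurable (fun x : sphere (0 : E) 1 => (⟨L x, by simp⟩ : sphere (0 : E) 1)) :=
    (Continuous.subtype_mk (L.continuous.comp continuous_subtype_val) _).measurable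
  refine ⟨hm, Measure.ext fun s hs => ?_⟩
  rw [Measure.map_apply hm hs, Measure.toSphere_apply' _ (hm hs), Measure.toSphere_apply' _ hs]
  have hL : MeasurePreserving L.toHomeomorph.toMeasurableEquiv (volume : Measure E) volume :=
    L.measurePreserving
  rw [← hL.measure_preimage_equiv (Ioo (0 : ℝ) 1 • (Subtype.val '' s))]
  congr 2
  ext y
  simp only [Set.mem_smul, Set.mem_preimage, Set.mem_image]
  constructor
  · rintro ⟨r, hr, _, ⟨x, hx, rfl⟩, rfl⟩
    exact ⟨r, hr, _, ⟨_, hx, rfl⟩, (L.map_smul r (x : E)).symm⟩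
  · rintro ⟨r, hr, _, ⟨x, hx, rfl⟩, h⟩
    refine ⟨r, hr, _, ⟨⟨L.symm x, by simp⟩, by simpa using hx, rfl⟩, ?_⟩
    apply L.injective
    change r • (x : E) = L y at h
    simp [h]

theorem integral_toSphere_coord_sq {n : ℕ} (i : Fin n) :
    ∫ ω : sphere (0 : En n) 1, ((ω : En n) i) ^ 2 ∂(volume : Measure (En n)).toSphere
      = (volume : Measure (En n)).real (ball 0 1) := by
  have hc : ∀ j : Fin n, Continuous fun ω : sphere (0 : En n) 1 => ((ω : En n) j) ^ 2 :=
    fun j => by fun_prop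
  have hsymm : ∀ j : Fin n,
      ∫ ω : sphere (0 : En n) 1, ((ω : En n) j) ^ 2 ∂(volume : Measure (En n)).toSphere
        = ∫ ω : sphere (0 : En n) 1, ((ω : En n) i) ^ 2 ∂(volume : Measure (En n)).toSphere := by
    intro j
    have hL := LinearIsometryEquiv.measurePreserving_toSphere
      (LinearIsometryEquiv.piLpCongrLeft 2 ℝ ℝ (Equiv.swap i j))
    conv_rhs => rw [← hL.map_eq]
    rw [integral_map hL.measurable.aemeasurable (hc i).aestronglyMeasurable]
    simp [LinearIsometryEquiv.piLpCongrLeft_apply, Equiv.piCongrLeft']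
  have hsum : ∑ j : Fin n,
      ∫ ω : sphere (0 : En n) 1, ((ω : En n) j) ^ 2 ∂(volume : Measure (En n)).toSphere
        = n * (volume : Measure (En n)).real (ball 0 1) := by
    rw [← integral_finsetSum _ fun j _ =>
      (hc j).integrable_of_hasCompactSupport (HasCompactSupport.of_compactSpace _)]
    have : ∀ ω : sphere (0 : En n) 1, ∑ j : Fin n, ((ω : En n) j) ^ 2 = 1 := fun ω => by
      rw [← EuclideanSpace.real_norm_sq_eq]; simp
    simp [this]
  rw [Finset.sum_congr rfl fun j _ => hsymm j] at hsum
  have : (n : ℝ) ≠ 0 := by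
    have := i.pos
    positivity
  simpa [this] using hsum

theorem pd_Hker {n : ℕ} (i : Fin n) (τ : ℝ) (y : En n) :
    pd i (Hker n τ) y = -(y i / 2) * coth τ * Hker n τ y := by
  have h := (((hasStrictFDerivAt_norm_sq y).hasFDerivAt.const_mul (-(1 / 4) : ℝ)).mul_const
    (coth τ)).exp
  unfold pd
  rw [show Hker n τ = fun y => Real.exp (-(1 / 4) * ‖y‖ ^ 2 * coth τ) from rfl, h.fderiv]
  simp [EuclideanSpace.inner_single_right]
  ring

theorem integral_sphere_pd_Hker {n : ℕ} (i : Fin n) (τ ε : ℝ) :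
    ∫ ω : sphere (0 : En n) 1,
      Sfac n τ * pd i (Hker n τ) (ε • (ω : En n)) * ((ω : En n) i)
        ∂(volume : Measure (En n)).toSphere
      = -(ε / 2) * Sfac n τ * coth τ * Real.exp (-(ε ^ 2 / 4) * coth τ)
        * (volume : Measure (En n)).real (ball 0 1) := by
  rw [← integral_toSphere_coord_sq i, ← integral_const_mul]
  congr 1 with ω
  rw [pd_Hker, Hker, norm_smul, norm_eq_of_mem_sphere, mul_one, Real.norm_eq_abs, sq_abs,
    show -(1 / 4) * ε ^ 2 * coth τ = -(ε ^ 2 / 4) * coth τ by ring]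
  simp only [PiLp.smul_apply, smul_eq_mul]
  ring

theorem one_le_mul_coth {t : ℝ} (ht : 0 < t) : 1 ≤ t * coth t := by
  have hs := Real.sinh_pos_iff.2 ht
  have hmono : MonotoneOn (fun x : ℝ => x * Real.cosh x - Real.sinh x) (Ici 0) := by
    have hd (x : ℝ) : HasDerivAt (fun x : ℝ => x * Real.cosh x - Real.sinh x)
        (x * Real.sinh x) x := by
      have h := ((hasDerivAt_id x).mul (Real.hasDerivAt_cosh x)).sub (Real.hasDerivAt_sinh x)
      exact h.congr_deriv (by simp only [id]; ring)
    refine monotoneOn_of_deriv_nonneg (convex_Ici 0)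
      (fun x _ => (hd x).continuousAt.continuousWithinAt)
      (fun x _ => (hd x).differentiableAt.differentiableWithinAt) fun x hx => ?_
    rw [(hd x).deriv]
    have hx' : 0 ≤ x := (by simpa using hx : 0 < x).le
    exact mul_nonneg hx' (Real.sinh_nonneg_iff.2 hx')
  have h := hmono (self_mem_Ici (a := (0 : ℝ))) (mem_Ici.2 ht.le) ht.le
  simp only [Real.cosh_zero, Real.sinh_zero, zero_mul, sub_zero] at h
  rw [coth, ← mul_div_assoc, one_le_div hs]
  linarith

theorem mul_coth_le_cosh {t : ℝ} (ht : 0 < t) : t * coth t ≤ Real.cosh t := by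
  have hs := Real.sinh_pos_iff.2 ht
  rw [coth, ← mul_div_assoc, div_le_iff₀ hs, mul_comm]
  exact mul_le_mul_of_nonneg_left (Real.self_le_sinh_iff.2 ht.le) (Real.cosh_pos t).le

theorem tendsto_sinh_div_self :
    Tendsto (fun t : ℝ => Real.sinh t / t) (𝓝[>] 0) (𝓝 1) := by
  have h := (Real.hasDerivAt_sinh 0).tendsto_slope_zero_right
  simpa [div_eq_inv_mul] using h

theorem tendsto_mul_coth : Tendsto (fun t : ℝ => t * coth t) (𝓝[>] 0) (𝓝 1) := by
  have hc : Tendsto Real.cosh (𝓝[>] 0) (𝓝 1) := by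
    simpa using Real.continuous_cosh.continuousWithinAt (s := Ioi 0) (x := 0) |>.tendsto
  refine tendsto_of_tendsto_of_tendsto_of_le_of_le' tendsto_const_nhds hc ?_ ?_
  · filter_upwards [self_mem_nhdsWithin] with t ht using one_le_mul_coth ht
  · filter_upwards [self_mem_nhdsWithin] with t ht using mul_coth_le_cosh ht

/-- The rescaled radial profile: its value at `t = 0⁺` is `exp (-u)`. -/
def mehlerProfile (n : ℕ) (t u : ℝ) : ℝ :=
  (Real.sinh (2 * t) / (2 * t)) ^ (-(n : ℝ) / 2) * (t * coth t) * Real.exp (-u * (t * coth t))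

theorem tendsto_mehlerProfile (n : ℕ) (u : ℝ) :
    Tendsto (fun t => mehlerProfile n t u) (𝓝[>] 0) (𝓝 (Real.exp (-u))) := by
  have h2 : Tendsto (fun t : ℝ => 2 * t) (𝓝[>] 0) (𝓝[>] 0) := by
    refine tendsto_nhdsWithin_iff.2 ⟨?_, ?_⟩
    · have : Tendsto (fun t : ℝ => 2 * t) (𝓝 0) (𝓝 (2 * 0)) := tendsto_id.const_mul 2
      rw [mul_zero] at this
      exact this.mono_left nhdsWithin_le_nhds
    · filter_upwards [self_mem_nhdsWithin] with t ht
      have : (0 : ℝ) < t := ht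
      simpa using this
  have hA := (tendsto_sinh_div_self.comp h2).rpow_const (p := -(n : ℝ) / 2) (Or.inl one_ne_zero)
  have hE := (Real.continuous_exp.tendsto _).comp (tendsto_mul_coth.const_mul (-u))
  simpa [mehlerProfile] using (hA.mul tendsto_mul_coth).mul hE

theorem abs_mehlerProfile_le (n : ℕ) {t u : ℝ} (ht : 0 < t) (ht1 : t ≤ 1) (hu : 0 ≤ u) :
    |mehlerProfile n t u| ≤ Real.cosh 1 * Real.exp (-u) := by
  have hB := one_le_mul_coth ht
  have hA : 1 ≤ Real.sinh (2 * t) / (2 * t) := by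
    rw [one_le_div (by positivity)]
    exact Real.self_le_sinh_iff.2 (by positivity)
  have hA' : (Real.sinh (2 * t) / (2 * t)) ^ (-(n : ℝ) / 2) ≤ 1 :=
    Real.rpow_le_one_of_one_le_of_nonpos hA (by
      have : (0 : ℝ) ≤ n := n.cast_nonneg
      linarith)
  have hA0 : 0 ≤ (Real.sinh (2 * t) / (2 * t)) ^ (-(n : ℝ) / 2) :=
    Real.rpow_nonneg (by linarith) _
  have hC : t * coth t ≤ Real.cosh 1 := (mul_coth_le_cosh ht).trans <|
    Real.cosh_le_cosh.2 (by rwa [abs_of_pos ht, abs_one])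
  have hE : Real.exp (-u * (t * coth t)) ≤ Real.exp (-u) := Real.exp_le_exp.2 (by nlinarith)
  rw [mehlerProfile, abs_of_nonneg (by positivity)]
  refine mul_le_mul ?_ hE (by positivity) (Real.cosh_pos 1).le
  calc _ ≤ 1 * (t * coth t) := mul_le_mul_of_nonneg_right hA' (by linarith)
    _ ≤ _ := by rwa [one_mul]

theorem integrableOn_exp_neg_mul_rpow {n : ℕ} (hn : 1 ≤ n) :
    IntegrableOn (fun u : ℝ => Real.exp (-u) * u ^ ((n : ℝ) / 2 - 1)) (Ioi (1 / 4)) := by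
  have : (0 : ℝ) < n := by exact_mod_cast hn
  exact (Real.GammaIntegral_convergent (by positivity : (0 : ℝ) < n / 2)).mono_set
    (Ioi_subset_Ioi (by norm_num))

theorem tendsto_integral_mehlerProfile {n : ℕ} (hn : 1 ≤ n) :
    Tendsto (fun ε : ℝ => ∫ u in Ioi (1 / 4 : ℝ),
        mehlerProfile n (ε ^ 2 / (4 * u)) u * u ^ ((n : ℝ) / 2 - 1)) (𝓝[>] 0)
      (𝓝 (∫ u in Ioi (1 / 4 : ℝ), Real.exp (-u) * u ^ ((n : ℝ) / 2 - 1))) := by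
  refine tendsto_integral_filter_of_dominated_convergence
    (fun u => Real.cosh 1 * (Real.exp (-u) * u ^ ((n : ℝ) / 2 - 1))) ?_ ?_
    ((integrableOn_exp_neg_mul_rpow hn).const_mul _) ?_
  · refine Eventually.of_forall fun ε => Measurable.aestronglyMeasurable ?_
    unfold mehlerProfile coth
    fun_prop
  · filter_upwards [Ioo_mem_nhdsGT (zero_lt_one' ℝ)] with ε hε
    filter_upwards [ae_restrict_mem measurableSet_Ioi] with u hu
    have hu' : (1 / 4 : ℝ) < u := hu
    have hu0 : 0 < u := by linarith
    have hε0 := hε.1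
    rw [norm_mul, Real.norm_eq_abs, Real.norm_of_nonneg (Real.rpow_nonneg hu0.le _), ← mul_assoc]
    refine mul_le_mul_of_nonneg_right (abs_mehlerProfile_le n (by positivity) ?_ hu0.le)
      (Real.rpow_nonneg hu0.le _)
    rw [div_le_one (by positivity)]
    nlinarith [hε.2]
  · filter_upwards [ae_restrict_mem measurableSet_Ioi] with u hu
    have hu' : (1 / 4 : ℝ) < u := hu
    have hu0 : 0 < u := by linarith
    refine ((tendsto_mehlerProfile n u).comp (tendsto_nhdsWithin_iff.2 ⟨?_, ?_⟩)).mul_const _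
    · have h : Continuous fun ε : ℝ => ε ^ 2 / (4 * u) := by fun_prop
      simpa using (h.tendsto 0).mono_left nhdsWithin_le_nhds
    · filter_upwards [self_mem_nhdsWithin] with ε hε
      have hε0 : 0 < ε := hε
      exact mem_Ioi.2 (by positivity)

theorem image_sq_div_Ioi {ε : ℝ} (hε : 0 < ε) :
    (fun u : ℝ => ε ^ 2 / (4 * u)) '' Ioi (1 / 4) = Ioo 0 (ε ^ 2) := by
  ext τ
  simp only [Set.mem_image, mem_Ioi, mem_Ioo]
  constructor
  · rintro ⟨u, hu, rfl⟩
    have hu0 : 0 < u := by linarith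
    refine ⟨by positivity, ?_⟩
    rw [div_lt_iff₀ (by positivity)]
    nlinarith [sq_pos_of_pos hε]
  · rintro ⟨h0, h1⟩
    refine ⟨ε ^ 2 / (4 * τ), ?_, by field_simp⟩
    rw [lt_div_iff₀ (by positivity)]
    linarith

theorem rescaled_integrand_eq (n : ℕ) {ε u : ℝ} (hε : 0 < ε) (hu : 0 < u) (V : ℝ) :
    |-(ε ^ 2 / (4 * u ^ 2))| * (ε ^ ((n : ℝ) - 1) *
      (-(ε / 2) * Sfac n (ε ^ 2 / (4 * u)) * coth (ε ^ 2 / (4 * u)) *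
        Real.exp (-(ε ^ 2 / 4) * coth (ε ^ 2 / (4 * u))) * V))
      = -(V / 2 * Real.pi ^ (-(n : ℝ) / 2)) *
        (mehlerProfile n (ε ^ 2 / (4 * u)) u * u ^ ((n : ℝ) / 2 - 1)) := by
  set t := ε ^ 2 / (4 * u) with ht
  have ht0 : 0 < t := by positivity
  have hs : 0 < Real.sinh (2 * t) := Real.sinh_pos_iff.2 (by positivity)
  have hπ := Real.pi_pos
  have hut : ε ^ 2 / 4 = u * t := by rw [ht]; field_simp
  have hS : Sfac n t = (Real.sinh (2 * t) / (2 * t)) ^ (-(n : ℝ) / 2) *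
      Real.pi ^ (-(n : ℝ) / 2) * (ε ^ (-(n : ℝ)) * u ^ ((n : ℝ) / 2)) := by
    have h1 : 2 * Real.pi * Real.sinh (2 * t) =
        Real.sinh (2 * t) / (2 * t) * Real.pi * (ε ^ 2 * u⁻¹) := by
      rw [show ε ^ 2 = 4 * (u * t) by linarith]
      field_simp
      ring
    rw [Sfac, h1, Real.mul_rpow (by positivity) (by positivity),
      Real.mul_rpow (by positivity) hπ.le, Real.mul_rpow (by positivity) (by positivity),
      ← Real.rpow_natCast ε 2, ← Real.rpow_mul hε.le, Real.inv_rpow hu.le,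
      ← Real.rpow_neg hu.le]
    congr 3 <;> push_cast <;> ring_nf
  have hεp : ε ^ ((n : ℝ) - 1) * ε ^ (-(n : ℝ)) * ε = 1 := by
    rw [← Real.rpow_add hε, show (n : ℝ) - 1 + -n = -1 by ring, Real.rpow_neg_one,
      inv_mul_cancel₀ hε.ne']
  have hup : u ^ ((n : ℝ) / 2) = u ^ ((n : ℝ) / 2 - 1) * u := by
    rw [Real.rpow_sub_one hu.ne']
    field_simp
  have ha : ε ^ 2 / (4 * u ^ 2) * u = t := by rw [ht]; field_simp
  rw [abs_neg, abs_of_pos (by positivity), hS, hup, mehlerProfile,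
    show -(ε ^ 2 / 4) * coth t = -u * (t * coth t) by rw [hut]; ring]
  generalize (Real.sinh (2 * t) / (2 * t)) ^ (-(n : ℝ) / 2) = A
  generalize Real.pi ^ (-(n : ℝ) / 2) = P
  generalize Real.exp (-u * (t * coth t)) = X
  generalize u ^ ((n : ℝ) / 2 - 1) = U at *
  linear_combination (-(1 / 2) * (ε ^ 2 / (4 * u ^ 2) * u) * A * P * U * coth t * X * V) * hεp
    + (-(1 / 2) * A * P * U * coth t * X * V) * ha

theorem integral_Ioo_eq_integral_mehlerProfile (n : ℕ) {ε : ℝ} (hε : 0 < ε) (V : ℝ) :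
    ∫ τ in Ioo (0 : ℝ) (ε ^ 2), ε ^ ((n : ℝ) - 1) *
      (-(ε / 2) * Sfac n τ * coth τ * Real.exp (-(ε ^ 2 / 4) * coth τ) * V)
      = -(V / 2 * Real.pi ^ (-(n : ℝ) / 2)) * ∫ u in Ioi (1 / 4 : ℝ),
        mehlerProfile n (ε ^ 2 / (4 * u)) u * u ^ ((n : ℝ) / 2 - 1) := by
  have hpos : ∀ u ∈ Ioi (1 / 4 : ℝ), 0 < u := fun u hu => lt_trans (by norm_num) hu
  rw [← image_sq_div_Ioi hε, integral_image_eq_integral_abs_deriv_smul measurableSet_Ioi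
    (f' := fun u => -(ε ^ 2 / (4 * u ^ 2))), ← integral_const_mul]
  · exact setIntegral_congr_fun measurableSet_Ioi fun u hu =>
      rescaled_integrand_eq n hε (hpos u hu) V
  · intro u hu
    have hu0 := hpos u hu
    have h := ((hasDerivAt_inv hu0.ne').const_mul (ε ^ 2 / 4)).hasDerivWithinAt (s := Ioi (1 / 4))
    refine (h.congr_deriv (by ring)).congr_of_mem (fun v _ => ?_) hu
    ring
  · intro u hu v hv h
    have hu0 := hpos u hu
    have hv0 := hpos v hv
    simp only at h
    field_simp at h
    linarith

theorem volume_real_unitBall_eq {n : ℕ} (hn : 1 ≤ n) :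
    (volume : Measure (En n)).real (ball 0 1) / 2 * Real.pi ^ (-(n : ℝ) / 2)
      = 1 / (n * Real.Gamma ((n : ℝ) / 2)) := by
  have hn0 : (0 : ℝ) < n := by exact_mod_cast hn
  have : Nonempty (Fin n) := ⟨⟨0, hn⟩⟩
  have hG := Real.Gamma_pos_of_pos (by positivity : (0 : ℝ) < n / 2)
  have hπ := Real.pi_pos
  have hp : Real.pi ^ (-(n : ℝ) / 2) = (√Real.pi ^ n)⁻¹ := by
    rw [Real.sqrt_eq_rpow, ← Real.rpow_natCast, ← Real.rpow_mul hπ.le, ← Real.rpow_neg hπ.le]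
    ring_nf
  have hq : √Real.pi ^ n ≠ 0 := by positivity
  rw [hp, measureReal_def, EuclideanSpace.volume_ball, Fintype.card_fin,
    Real.Gamma_add_one (by positivity)]
  rw [ENNReal.ofReal_one, one_pow, one_mul, ENNReal.toReal_ofReal (by positivity)]
  field_simp

/-- the boundary term of the Mehler kernel computation:
`∫₀^{ε²} ∫_{|y|=ε} S(τ) ∂_{y_i}H(τ,y) (y_i/|y|) dσ(y) dτ → -(1/(nΓ(n/2))) ∫_{1/4}^∞ e^{-u} u^{n/2-1} du`
as `ε → 0⁺`. The surface integral over the sphere of radius `ε` is written, by scaling, as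
`ε^{n-1}` times the integral over the unit sphere (with its surface measure
`(volume).toSphere`) of the integrand evaluated at `y = ε·ω`, where `y_i/|y| = ω_i`. -/
theorem mehler_sphere_boundary_limit (n : ℕ) (hn : 1 ≤ n) (i : Fin n) :
    Tendsto
      (fun ε : ℝ => ∫ τ in Set.Ioo (0 : ℝ) (ε ^ 2),
        ε ^ ((n : ℝ) - 1) *
          ∫ ω : Metric.sphere (0 : En n) 1,
            Sfac n τ * pd i (Hker n τ) (ε • (ω : En n)) * ((ω : En n) i)
          ∂(volume : Measure (En n)).toSphere)
      (𝓝[>] 0)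
      (𝓝 (-(1 / (n * Real.Gamma ((n : ℝ) / 2))) *
          ∫ u in Set.Ioi (1 / 4 : ℝ), Real.exp (-u) * u ^ ((n : ℝ) / 2 - 1))) := by
  refine ((tendsto_integral_mehlerProfile hn).const_mul _).congr' ?_
  filter_upwards [self_mem_nhdsWithin] with ε hε
  simp only [integral_sphere_pd_Hker]
  rw [integral_Ioo_eq_integral_mehlerProfile n hε, volume_real_unitBall_eq hn]
end
end
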